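/- Let p ≥ 1, let λ = (λ₁,…,λ_p) be nonincreasing nonnegative weights, and let γ ≥ 0. For every u ∈ ℝ^p, the SLOPE proximal operator satisfies η(u; γ, λ) = u − Π_{D_γ}(u), where Π_{D_γ}(u) is the (unique) Euclidean projection of u onto the closed convex set D_γ = { v ∈ ℝ^p : Σ_{i=1}^j |v|_{(i)} ≤ γ Σ_{i=1}^j λ_i for all 1 ≤ j ≤ p }. That is, u − η(u; γ, λ) is the unique minimizer of ‖u − v‖₂² over v ∈ D_γ. -/

import Mathlib

open MeasureTheory ProbabilityTheory Filter

/-- Standard Gaussian measure `N(0, I_n)` on `ℝⁿ`. -/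
noncomputable def stdGaussian (n : ℕ) : Measure (Fin n → ℝ) :=
  Measure.pi fun _ => gaussianReal 0 1

/-- The nonincreasing rearrangement of the absolute values of the entries of `x`. -/
noncomputable def sortedAbs {n : ℕ} (x : Fin n → ℝ) : Fin n → ℝ :=
  fun i => |x ((Tuple.sort fun j => -|x j|) i)|

/-- The sorted-ℓ1 (SLOPE) norm `‖x‖_λ = ∑ λ_i |x|_(i)`. -/
noncomputable def slopeNorm {n : ℕ} (lam x : Fin n → ℝ) : ℝ :=
  ∑ i, lam i * sortedAbs x i

/-- The SLOPE proximal objective `½‖u − v‖₂² + γ‖v‖_λ`. -/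
noncomputable def slopeObj {n : ℕ} (lam : Fin n → ℝ) (γ : ℝ) (u v : Fin n → ℝ) : ℝ :=
  (1/2) * ∑ i, (u i - v i)^2 + γ * slopeNorm lam v

/-- `v` is a minimizer of the SLOPE proximal objective, i.e. `v = η(u; γ, λ)`
(the minimizer is unique since the objective is strictly convex). -/
def IsSlopeProx {n : ℕ} (lam : Fin n → ℝ) (γ : ℝ) (u v : Fin n → ℝ) : Prop :=
  ∀ w, slopeObj lam γ u v ≤ slopeObj lam γ u w

/-- The dual SLOPE norm ball of radius `γ`:
`D_γ = { v : Σ_{i≤j} |v|_(i) ≤ γ Σ_{i≤j} λ_i for all 1 ≤ j ≤ n }`. -/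
noncomputable def slopeDualBall {n : ℕ} (lam : Fin n → ℝ) (γ : ℝ) : Set (Fin n → ℝ) :=
  {v | ∀ j : ℕ, 1 ≤ j → j ≤ n →
    (∑ i : Fin n, if (i : ℕ) < j then sortedAbs v i else 0)
      ≤ γ * ∑ i : Fin n, if (i : ℕ) < j then lam i else 0}

lemma antitone_sortedAbs {n : ℕ} (x : Fin n → ℝ) : Antitone (sortedAbs x) := by
  intro i j hij
  have h := Tuple.monotone_sort (fun j => -|x j|) hij
  simpa [sortedAbs] using h

lemma sortedAbs_nonneg {n : ℕ} (x : Fin n → ℝ) (i : Fin n) : 0 ≤ sortedAbs x i :=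
  abs_nonneg _

/-- Rearrangement inequality: pairing antitone weights with the sorted absolute values
dominates pairing them with any other ordering of the absolute values. -/
lemma sum_mul_abs_comp_perm_le_slopeNorm {n : ℕ} {lam : Fin n → ℝ} (hlam : Antitone lam)
    (x : Fin n → ℝ) (σ : Equiv.Perm (Fin n)) :
    ∑ i, lam i * |x (σ i)| ≤ slopeNorm lam x := by
  have h := (hlam.monovary (antitone_sortedAbs x)).sum_mul_comp_perm_le_sum_mul
    (σ := (Tuple.sort fun j => -|x j|)⁻¹ * σ)
  simpa [sortedAbs, slopeNorm] using h

lemma slopeNorm_add_le {n : ℕ} {lam : Fin n → ℝ} (hlam : Antitone lam) (h0 : ∀ i, 0 ≤ lam i)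
    (x y : Fin n → ℝ) : slopeNorm lam (x + y) ≤ slopeNorm lam x + slopeNorm lam y := by
  set σ := Tuple.sort fun j => -|(x + y) j|
  calc slopeNorm lam (x + y) ≤ ∑ i, (lam i * |x (σ i)| + lam i * |y (σ i)|) := by
        refine Finset.sum_le_sum fun i _ => ?_
        rw [← mul_add]
        exact mul_le_mul_of_nonneg_left (abs_add_le _ _) (h0 i)
    _ ≤ slopeNorm lam x + slopeNorm lam y := by
        rw [Finset.sum_add_distrib]
        exact add_le_add (sum_mul_abs_comp_perm_le_slopeNorm hlam x σ)
          (sum_mul_abs_comp_perm_le_slopeNorm hlam y σ)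

lemma slopeNorm_smul_le {n : ℕ} {lam : Fin n → ℝ} (hlam : Antitone lam) {t : ℝ} (ht : 0 ≤ t)
    (x : Fin n → ℝ) : slopeNorm lam (t • x) ≤ t * slopeNorm lam x := by
  set σ := Tuple.sort fun j => -|(t • x) j|
  have h : slopeNorm lam (t • x) = t * ∑ i, lam i * |x (σ i)| := by
    rw [Finset.mul_sum]
    refine Finset.sum_congr rfl fun i _ => ?_
    change lam i * |t * x (σ i)| = t * (lam i * |x (σ i)|)
    rw [abs_mul, abs_of_nonneg ht]
    ring
  rw [h]
  exact mul_le_mul_of_nonneg_left (sum_mul_abs_comp_perm_le_slopeNorm hlam x σ) ht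

/-- Abel summation: nonnegative partial sums, paired with antitone weights. -/
lemma sum_range_mul_le_sum_range_mul {a b : ℕ → ℝ} (hb : Antitone b)
    (ha : ∀ j, 0 ≤ ∑ i ∈ Finset.range j, a i) (n : ℕ) :
    (∑ i ∈ Finset.range n, a i) * b n ≤ ∑ i ∈ Finset.range n, a i * b i := by
  induction n with
  | zero => simp
  | succ n ih =>
    have h := mul_le_mul_of_nonneg_left (hb n.le_succ) (ha (n + 1))
    rw [Finset.sum_range_succ] at h ⊢
    rw [Finset.sum_range_succ]
    linarith

lemma sum_fin_ite_lt_eq_sum_range {n j : ℕ} (a : Fin n → ℝ) (hj : j ≤ n) :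
    (∑ i : Fin n, if (i : ℕ) < j then a i else 0) =
      ∑ i ∈ Finset.range j, if h : i < n then a ⟨i, h⟩ else 0 := by
  have h := Fin.sum_univ_eq_sum_range
    (fun i => if i < j then (if h : i < n then a ⟨i, h⟩ else 0) else 0) n
  simp only [Fin.is_lt, dite_true, Fin.eta] at h
  rw [h, ← Finset.sum_filter]
  congr 1
  ext i
  simp only [Finset.mem_filter, Finset.mem_range]
  omega

lemma sum_mul_nonneg_of_partial_sums_nonneg {n : ℕ} {a b : Fin n → ℝ} (hb : Antitone b)
    (hb0 : ∀ i, 0 ≤ b i)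
    (ha : ∀ j : ℕ, 1 ≤ j → j ≤ n → 0 ≤ ∑ i : Fin n, if (i : ℕ) < j then a i else 0) :
    0 ≤ ∑ i, a i * b i := by
  let a' : ℕ → ℝ := fun i => if h : i < n then a ⟨i, h⟩ else 0
  let b' : ℕ → ℝ := fun i => if h : i < n then b ⟨i, h⟩ else 0
  have hb' : Antitone b' := by
    intro i j hij
    by_cases hj : j < n
    · have hi : i < n := lt_of_le_of_lt hij hj
      simp only [b', hi, hj, dite_true]
      exact hb hij
    · simp only [b', hj, dite_false]
      split_ifs
      exacts [hb0 _, le_rfl]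
  have ha_le : ∀ j ≤ n, 0 ≤ ∑ i ∈ Finset.range j, a' i := by
    intro j hj
    rcases Nat.eq_zero_or_pos j with rfl | h1
    · simp
    · rw [← sum_fin_ite_lt_eq_sum_range a hj]
      exact ha j h1 hj
  have ha' : ∀ j, 0 ≤ ∑ i ∈ Finset.range j, a' i := by
    intro j
    rcases le_total j n with hj | hj
    · exact ha_le j hj
    · rw [← Finset.sum_subset (Finset.range_subset_range.2 hj)]
      · exact ha_le n le_rfl
      · intro i _ hi
        have hi' : ¬ i < n := by simpa using hi
        simp [a', hi']
  have h := sum_range_mul_le_sum_range_mul hb' ha' n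
  have hbn : b' n = 0 := by simp [b']
  rw [hbn, mul_zero, ← Fin.sum_univ_eq_sum_range (fun i => a' i * b' i)] at h
  simpa [a', b'] using h

/-- The set `D_γ` is the polar set of the SLOPE norm. -/
lemma mem_slopeDualBall_iff {n : ℕ} {lam : Fin n → ℝ} (hlam : Antitone lam)
    (h0 : ∀ i, 0 ≤ lam i) {γ : ℝ} (hγ : 0 ≤ γ) (w : Fin n → ℝ) :
    w ∈ slopeDualBall lam γ ↔ ∀ x : Fin n → ℝ, ∑ i, w i * x i ≤ γ * slopeNorm lam x := by
  constructor
  · intro hw x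
    set σ := Tuple.sort fun j => -|x j|
    calc ∑ i, w i * x i = ∑ i, w (σ i) * x (σ i) :=
          (Equiv.sum_comp σ fun i => w i * x i).symm
      _ ≤ ∑ i, sortedAbs x i * |w (σ i)| := by
          refine Finset.sum_le_sum fun i _ => (le_abs_self _).trans ?_
          rw [abs_mul, mul_comm]
          rfl
      _ ≤ slopeNorm (sortedAbs x) w :=
          sum_mul_abs_comp_perm_le_slopeNorm (antitone_sortedAbs x) w σ
      _ ≤ γ * slopeNorm lam x := by
          have h := sum_mul_nonneg_of_partial_sums_nonneg
            (a := fun i => γ * lam i - sortedAbs w i) (antitone_sortedAbs x)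
            (sortedAbs_nonneg x) (fun j h1 hj => by
              have := hw j h1 hj
              rw [Finset.mul_sum, ← sub_nonneg, ← Finset.sum_sub_distrib] at this
              refine this.trans_eq (Finset.sum_congr rfl fun i _ => ?_)
              split_ifs <;> simp)
          rw [← sub_nonneg, slopeNorm, slopeNorm, Finset.mul_sum, ← Finset.sum_sub_distrib]
          refine h.trans_eq (Finset.sum_congr rfl fun i _ => ?_)
          ring
  · intro hw j _ _
    set σ := Tuple.sort fun k => -|w k|
    let ind : Fin n → ℝ := fun i => if (i : ℕ) < j then 1 else 0
    let x : Fin n → ℝ := fun k => SignType.sign (w k) * ind (σ⁻¹ k)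
    have hind : Antitone ind := by
      intro a b hab
      have hab' : (a : ℕ) ≤ b := hab
      simp only [ind]
      split_ifs <;> first | omega | norm_num
    have hind0 : ∀ i, 0 ≤ ind i := by
      intro i
      simp only [ind]
      split_ifs <;> norm_num
    have hx : ∀ k, |x k| ≤ ind (σ⁻¹ k) := by
      intro k
      rw [abs_mul, abs_of_nonneg (hind0 _)]
      refine mul_le_of_le_one_left (hind0 _) ?_
      rcases SignType.sign (w k) with _ | _ | _ <;> simp
    have hpair : ∑ i, w i * x i = ∑ i : Fin n, if (i : ℕ) < j then sortedAbs w i else 0 := by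
      rw [← Equiv.sum_comp σ]
      refine Finset.sum_congr rfl fun i _ => ?_
      have hs := self_mul_sign (w (σ i))
      have hi : σ⁻¹ (σ i) = i := σ.symm_apply_apply i
      have hsort : sortedAbs w i = |w (σ i)| := rfl
      simp only [x, ← mul_assoc, hs, hi, hsort, ind]
      split_ifs <;> simp
    have hnorm : slopeNorm lam x ≤ ∑ i : Fin n, if (i : ℕ) < j then lam i else 0 := by
      set τ := Tuple.sort fun k => -|x k|
      calc slopeNorm lam x ≤ ∑ i, lam i * ind ((σ⁻¹ * τ) i) :=
            Finset.sum_le_sum fun i _ => mul_le_mul_of_nonneg_left (hx _) (h0 i)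
        _ ≤ ∑ i, lam i * ind i := (hlam.monovary hind).sum_mul_comp_perm_le_sum_mul
        _ = _ := by simp [ind]
    rw [← hpair]
    exact (hw x).trans (mul_le_mul_of_nonneg_left hnorm hγ)

lemma slopeDualBall_eq_iInter {n : ℕ} {lam : Fin n → ℝ} (hlam : Antitone lam)
    (h0 : ∀ i, 0 ≤ lam i) {γ : ℝ} (hγ : 0 ≤ γ) :
    slopeDualBall lam γ =
      ⋂ x : Fin n → ℝ, {w | ∑ i, w i * x i ≤ γ * slopeNorm lam x} := by
  ext w
  simp [mem_slopeDualBall_iff hlam h0 hγ]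

lemma nonpos_of_forall_mul_le_sq {a b : ℝ} (h : ∀ t : ℝ, 0 < t → t ≤ 1 → t * a ≤ t ^ 2 * b) :
    a ≤ 0 := by
  by_contra! ha
  have hb : 0 < |b| + a + 1 := by positivity
  have ht : 0 < a / (|b| + a + 1) := by positivity
  have h1 : a / (|b| + a + 1) ≤ 1 := by
    rw [div_le_one hb]
    linarith [abs_nonneg b]
  have h2 := h _ ht h1
  rw [pow_two, mul_assoc] at h2
  have h3 := le_of_mul_le_mul_left h2 ht
  rw [div_mul_eq_mul_div, le_div_iff₀ hb] at h3
  nlinarith [le_abs_self b]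

/-- First-order condition at a SLOPE minimizer along a direction with controlled penalty growth. -/
lemma IsSlopeProx.sum_sub_mul_le {n : ℕ} {lam : Fin n → ℝ} {γ : ℝ} (hγ : 0 ≤ γ)
    {u v : Fin n → ℝ} (hv : IsSlopeProx lam γ u v) (x : Fin n → ℝ) {c : ℝ}
    (hc : ∀ t : ℝ, 0 < t → t ≤ 1 → slopeNorm lam (v + t • x) ≤ slopeNorm lam v + t * c) :
    ∑ i, (u i - v i) * x i ≤ γ * c := by
  rw [← sub_nonpos]
  refine nonpos_of_forall_mul_le_sq (b := (1 / 2) * ∑ i, x i ^ 2) fun t ht ht1 => ?_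
  have h := hv (v + t • x)
  have hexp : ∑ i, (u i - (v + t • x) i) ^ 2 =
      ∑ i, (u i - v i) ^ 2 - 2 * t * ∑ i, (u i - v i) * x i + t ^ 2 * ∑ i, x i ^ 2 := by
    simp only [Finset.mul_sum, ← Finset.sum_sub_distrib, ← Finset.sum_add_distrib]
    refine Finset.sum_congr rfl fun i _ => ?_
    simp only [Pi.add_apply, Pi.smul_apply, smul_eq_mul]
    ring
  rw [slopeObj, slopeObj, hexp] at h
  have h' := mul_le_mul_of_nonneg_left (hc t ht ht1) hγ
  linarith

/-- `η(u; γ, λ) = u − Π_{D_γ}(u)`: the dual ball `D_γ` is closed and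
convex, `u − η(u; γ, λ)` belongs to it, and it is the unique minimizer of
`‖u − v‖₂²` over `v ∈ D_γ`. -/
theorem slope_prox_eq_residual_of_projection
    (p : ℕ) (hp : 1 ≤ p)
    (lam : Fin p → ℝ)
    (hmono : ∀ i j : Fin p, i ≤ j → lam j ≤ lam i)
    (hnonneg : ∀ i, 0 ≤ lam i)
    (γ : ℝ) (hγ : 0 ≤ γ)
    (u v : Fin p → ℝ) (hv : IsSlopeProx lam γ u v) :
    Convex ℝ (slopeDualBall lam γ) ∧ IsClosed (slopeDualBall lam γ) ∧
    (fun i => u i - v i) ∈ slopeDualBall lam γ ∧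
    ∀ w ∈ slopeDualBall lam γ, w ≠ (fun i => u i - v i) →
      (∑ i, (v i) ^ 2) < ∑ i, (u i - w i) ^ 2 := by
  have hlam : Antitone lam := fun i j hij => hmono i j hij
  have hmem : (fun i => u i - v i) ∈ slopeDualBall lam γ := by
    rw [mem_slopeDualBall_iff hlam hnonneg hγ]
    intro x
    refine hv.sum_sub_mul_le hγ x fun t ht _ => ?_
    exact (slopeNorm_add_le hlam hnonneg _ _).trans
      (add_le_add le_rfl (slopeNorm_smul_le hlam ht.le x))
  have hinner : γ * slopeNorm lam v ≤ ∑ i, (u i - v i) * v i := by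
    have h := hv.sum_sub_mul_le hγ (-v) (c := -slopeNorm lam v) fun t _ ht1 => by
      have hvec : v + t • -v = (1 - t) • v := by
        rw [sub_smul, one_smul, smul_neg, sub_eq_add_neg]
      rw [hvec]
      have := slopeNorm_smul_le hlam (sub_nonneg.2 ht1) v
      linarith
    simp only [Pi.neg_apply, mul_neg, Finset.sum_neg_distrib] at h
    linarith
  refine ⟨?_, ?_, hmem, ?_⟩
  · rw [slopeDualBall_eq_iInter hlam hnonneg hγ]
    refine convex_iInter fun x => convex_halfSpace_le ⟨fun a b => ?_, fun c a => ?_⟩ _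
    · simp [add_mul, Finset.sum_add_distrib]
    · simp [Finset.mul_sum, mul_assoc]
  · rw [slopeDualBall_eq_iInter hlam hnonneg hγ]
    exact isClosed_iInter fun x => isClosed_le (by fun_prop) continuous_const
  · intro w hw hne
    have hwv := (mem_slopeDualBall_iff hlam hnonneg hγ w).1 hw v
    have hpos : 0 < ∑ i, (u i - v i - w i) ^ 2 := by
      obtain ⟨i, hi⟩ := Function.ne_iff.1 hne
      exact Finset.sum_pos' (fun i _ => sq_nonneg _)
        ⟨i, Finset.mem_univ i, sq_pos_of_ne_zero (sub_ne_zero.2 (Ne.symm hi))⟩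
    have hexp : ∑ i, (u i - w i) ^ 2 = ∑ i, v i ^ 2 +
        2 * (∑ i, (u i - v i) * v i - ∑ i, w i * v i) + ∑ i, (u i - v i - w i) ^ 2 := by
      simp only [Finset.mul_sum, ← Finset.sum_sub_distrib, ← Finset.sum_add_distrib]
      refine Finset.sum_congr rfl fun i _ => ?_
      ring
    linarith
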